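/- Let U be an open subset of {(x,y,z,w) ∈ ℝ⁴ : z ≠ 0}, and consider on U the two vector fields X₁ = z ∂/∂y − y ∂/∂z and X₂ = ∂/∂x + w ∂/∂y + y ∂/∂w. If a smooth function f : U → ℝ satisfies X₁ f = 0 and X₂ f = 0 on U, then for every point p ∈ U there exist an open neighborhood V ⊆ U of p and a smooth function g : ℝ → ℝ such that f(x,y,z,w) = g(y² + z² − w²) for all (x,y,z,w) ∈ V. That is, the basic joint invariant of X₁ and X₂ is y² + z² − w². -/

import Mathlib

/-- The action of a vector field `X` on a smooth function `f`:
`(X f)(q) = Df(q)(X(q))`. -/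
noncomputable def vAct {n : ℕ} (X : (Fin n → ℝ) → (Fin n → ℝ))
    (f : (Fin n → ℝ) → ℝ) : (Fin n → ℝ) → ℝ :=
  fun q => fderiv ℝ f q (X q)

open VectorField in
/-- A function annihilated by two differentiable vector fields on an open set is annihilated by
their Lie bracket there. -/
lemma fderiv_lieBracket_eq_zero {E : Type*} [NormedAddCommGroup E] [NormedSpace ℝ E]
    {U : Set E} (hU : IsOpen U) {f : E → ℝ} (hf : ContDiffOn ℝ (⊤ : ℕ∞) f U) {V W : E → E}
    (hV : Differentiable ℝ V) (hW : Differentiable ℝ W)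
    (hfV : ∀ q ∈ U, fderiv ℝ f q (V q) = 0) (hfW : ∀ q ∈ U, fderiv ℝ f q (W q) = 0) :
    ∀ q ∈ U, fderiv ℝ f q (lieBracket ℝ V W q) = 0 := by
  intro q hq
  have hfq : ContDiffAt ℝ (⊤ : ℕ∞) f q := hf.contDiffAt (hU.mem_nhds hq)
  have hdf : DifferentiableAt ℝ (fderiv ℝ f) q :=
    (hfq.fderiv_right (m := 1) (by norm_cast)).differentiableAt (by simp)
  have hsymm : IsSymmSndFDerivAt ℝ f q := hfq.isSymmSndFDerivAt (by
    simpa using WithTop.coe_le_coe.2 (le_top : (2 : ℕ∞) ≤ ⊤))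
  have key : ∀ Z : E → E, Differentiable ℝ Z → (∀ r ∈ U, fderiv ℝ f r (Z r) = 0) → ∀ h,
      fderiv ℝ f q (fderiv ℝ Z q h) + fderiv ℝ (fderiv ℝ f) q h (Z q) = 0 := by
    intro Z hZ hfZ h
    have hd := hdf.hasFDerivAt.clm_apply (hZ q).hasFDerivAt
    have hz : (fun r => fderiv ℝ f r (Z r)) =ᶠ[nhds q] fun _ => 0 := by
      filter_upwards [hU.mem_nhds hq] with r hr using hfZ r hr
    have := hd.unique ((hasFDerivAt_const (0 : ℝ) q).congr_of_eventuallyEq hz)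
    simpa using congrArg (fun L => L h) this
  have h₁ := key V hV hfV (W q)
  have h₂ := key W hW hfW (V q)
  have h₃ := hsymm (V q) (W q)
  rw [lieBracket_eq, map_sub]
  linarith

/-- The derivative of a vector field on `ℝ⁴`, one component at a time. -/
lemma hasFDerivAt_vec4 {a b c d : (Fin 4 → ℝ) → ℝ} {a' b' c' d' : (Fin 4 → ℝ) →L[ℝ] ℝ}
    {q : Fin 4 → ℝ} (ha : HasFDerivAt a a' q) (hb : HasFDerivAt b b' q)
    (hc : HasFDerivAt c c' q) (hd : HasFDerivAt d d' q) :
    HasFDerivAt (fun x => ![a x, b x, c x, d x]) (ContinuousLinearMap.pi ![a', b', c', d']) q := by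
  refine hasFDerivAt_pi.2 fun i => ?_
  fin_cases i <;> assumption

/-- A function smooth near a point agrees near that point with a globally smooth function. -/
lemma exists_contDiff_eqOn_ball {h : ℝ → ℝ} {s δ : ℝ} (hδ : 0 < δ)
    (hh : ContDiffOn ℝ (⊤ : ℕ∞) h (Metric.ball s δ)) :
    ∃ g : ℝ → ℝ, ContDiff ℝ (⊤ : ℕ∞) g ∧ Set.EqOn g h (Metric.ball s (δ / 3)) := by
  let χ : ContDiffBump s := ⟨δ / 3, δ / 2, by positivity, by linarith⟩
  refine ⟨fun t => χ t * h t, contDiff_iff_contDiffAt.2 fun t => ?_, fun t ht => ?_⟩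
  · by_cases ht : t ∈ Metric.ball s δ
    · exact χ.contDiff.contDiffAt.mul (hh.contDiffAt (Metric.isOpen_ball.mem_nhds ht))
    · have ht' : t ∈ (Metric.closedBall s (δ / 2))ᶜ := by
        simp only [Metric.mem_ball, not_lt, Set.mem_compl_iff, Metric.mem_closedBall, not_le] at ht ⊢
        linarith
      have hz : (fun t => χ t * h t) =ᶠ[nhds t] fun _ => 0 := by
        filter_upwards [Metric.isClosed_closedBall.isOpen_compl.mem_nhds ht'] with r hr
        have : χ r = 0 := χ.zero_of_le_dist (by
          simp only [Set.mem_compl_iff, Metric.mem_closedBall, not_le] at hr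
          exact hr.le)
        simp [this]
      exact contDiffAt_const.congr_of_eventuallyEq hz
  · simp [χ.one_of_mem_closedBall (Metric.ball_subset_closedBall ht)]

/-- A joint invariant of `X₁ = z∂y − y∂z` and `X₂ = ∂x + w∂y + y∂w` on `ℝ⁴`
(coordinates `(x, y, z, w)`, with `z ≠ 0`) is locally a smooth function of
`y² + z² − w²`. -/
theorem two_fields_R4_joint_invariant (U : Set (Fin 4 → ℝ)) (hU : IsOpen U)
    (hU' : ∀ p ∈ U, p 2 ≠ 0)
    (f : (Fin 4 → ℝ) → ℝ) (hf : ContDiffOn ℝ (⊤ : ℕ∞) f U)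
    (hX1 : ∀ q ∈ U, vAct (fun x => ![0, x 2, -x 1, 0]) f q = 0)
    (hX2 : ∀ q ∈ U, vAct (fun x => ![1, x 3, 0, x 1]) f q = 0) :
    ∀ p ∈ U, ∃ V : Set (Fin 4 → ℝ), IsOpen V ∧ p ∈ V ∧ V ⊆ U ∧
      ∃ g : ℝ → ℝ, ContDiff ℝ (⊤ : ℕ∞) g ∧
        ∀ q ∈ V, f q = g (q 1 ^ 2 + q 2 ^ 2 - q 3 ^ 2) := by
  have hL := fun (i : Fin 4) (q : Fin 4 → ℝ) =>
    (ContinuousLinearMap.proj (R := ℝ) (φ := fun _ : Fin 4 => ℝ) i).hasFDerivAt (x := q)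
  have hK := fun (c : ℝ) (q : Fin 4 → ℝ) => hasFDerivAt_const (𝕜 := ℝ) c q
  have hd₁ : ∀ q, HasFDerivAt (fun x : Fin 4 → ℝ => ![0, x 2, -x 1, 0]) _ q := fun q =>
    hasFDerivAt_vec4 (hK 0 q) (hL 2 q) (hL 1 q).neg (hK 0 q)
  have hd₂ : ∀ q, HasFDerivAt (fun x : Fin 4 → ℝ => ![1, x 3, 0, x 1]) _ q := fun q =>
    hasFDerivAt_vec4 (hK 1 q) (hL 3 q) (hK 0 q) (hL 1 q)
  have hd₃ : ∀ q, HasFDerivAt (fun x : Fin 4 → ℝ => ![0, 0, x 3, x 2]) _ q := fun q =>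
    hasFDerivAt_vec4 (hK 0 q) (hK 0 q) (hL 3 q) (hL 2 q)
  have hX3 : ∀ q ∈ U, fderiv ℝ f q ![0, 0, q 3, q 2] = 0 := by
    intro q hq
    convert fderiv_lieBracket_eq_zero hU hf (fun q => (hd₁ q).differentiableAt)
      (fun q => (hd₂ q).differentiableAt) hX1 hX2 q hq using 2
    rw [VectorField.lieBracket, (hd₁ q).fderiv, (hd₂ q).fderiv]
    ext i; fin_cases i <;> simp
  have hX4 : ∀ q ∈ U, fderiv ℝ f q ![0, - q 3, 0, - q 1] = 0 := by
    intro q hq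
    convert fderiv_lieBracket_eq_zero hU hf (fun q => (hd₁ q).differentiableAt)
      (fun q => (hd₃ q).differentiableAt) hX1 hX3 q hq using 2
    rw [VectorField.lieBracket, (hd₁ q).fderiv, (hd₃ q).fderiv]
    ext i; fin_cases i <;> simp
  have htan : ∀ q ∈ U, ∀ v : Fin 4 → ℝ, q 1 * v 1 + q 2 * v 2 - q 3 * v 3 = 0 →
      fderiv ℝ f q v = 0 := by
    intro q hq v hv
    have hz := hU' q hq
    have hdec : v = v 0 • (![1, q 3, 0, q 1] + ![0, - q 3, 0, - q 1])
        + (v 1 / q 2) • ![0, q 2, - q 1, 0] + (v 3 / q 2) • ![0, 0, q 3, q 2] := by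
      ext i; fin_cases i <;> simp <;> field_simp
      linarith
    have h₁ := hX1 q hq
    have h₂ := hX2 q hq
    simp only [vAct] at h₁ h₂
    rw [hdec]
    simp only [map_add, map_smul, h₁, h₂, hX3 q hq, hX4 q hq]
    simp
  intro p hp
  have hpz := hU' p hp
  obtain ⟨σ, hσ, hσp⟩ : ∃ σ : ℝ, σ * σ = 1 ∧ 0 < σ * p 2 := by
    rcases lt_or_gt_of_ne hpz with h | h
    · exact ⟨-1, by norm_num, by linarith⟩
    · exact ⟨1, by norm_num, by linarith⟩
  let S : (Fin 4 → ℝ) → ℝ := fun q => q 1 ^ 2 + q 2 ^ 2 - q 3 ^ 2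
  let R : (Fin 4 → ℝ) → ℝ := fun a => a 2 - a 1 ^ 2 + a 3 ^ 2
  -- `Ψ` straightens the level sets of the invariant `S`, and `Φ` is its local inverse.
  let Ψ : (Fin 4 → ℝ) → (Fin 4 → ℝ) := fun q => ![q 0, q 1, S q, q 3]
  let Φ : (Fin 4 → ℝ) → (Fin 4 → ℝ) := fun a => ![a 0, a 1, σ * √(R a), a 3]
  have hΨc : Continuous Ψ := by
    refine continuous_pi fun i => ?_
    fin_cases i <;> simp [Ψ, S] <;> fun_prop
  have hRc : Continuous R := by fun_prop
  have hΦc : Continuous Φ := by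
    refine continuous_pi fun i => ?_
    fin_cases i <;> simp [Φ] <;> fun_prop
  have hRΨ : ∀ q, R (Ψ q) = q 2 ^ 2 := fun q => by simp [R, Ψ, S]; ring
  have hΦΨ : ∀ q, 0 < σ * q 2 → Φ (Ψ q) = q := by
    intro q hq
    have h : √(R (Ψ q)) = σ * q 2 := by
      rw [hRΨ, show q 2 ^ 2 = (σ * q 2) ^ 2 by linear_combination (-q 2 ^ 2) * hσ,
        Real.sqrt_sq hq.le]
    have h' : σ * √(R (Ψ q)) = q 2 := by rw [h, ← mul_assoc, hσ, one_mul]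
    ext i
    fin_cases i
    · rfl
    · rfl
    · exact h'
    · rfl
  obtain ⟨δ, hδ, hball⟩ : ∃ δ > 0, Metric.ball (Ψ p) δ ⊆ Φ ⁻¹' U ∩ R ⁻¹' Set.Ioi 0 := by
    refine Metric.isOpen_iff.1 ((hU.preimage hΦc).inter (isOpen_Ioi.preimage hRc)) _ ⟨?_, ?_⟩
    · rwa [Set.mem_preimage, hΦΨ p hσp]
    · rw [Set.mem_preimage, hRΨ, Set.mem_Ioi]; positivity
  have hΦs : ∀ a ∈ Metric.ball (Ψ p) δ, ContDiffAt ℝ (⊤ : ℕ∞) Φ a := by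
    intro a ha
    have hR : R a ≠ 0 := (hball ha).2.ne'
    have hRs : ContDiffAt ℝ (⊤ : ℕ∞) R a := by fun_prop
    refine contDiffAt_pi.2 fun i => ?_
    fin_cases i
    · exact contDiffAt_apply ..
    · exact contDiffAt_apply ..
    · exact contDiffAt_const.mul (hRs.sqrt hR)
    · exact contDiffAt_apply ..
  have hF : ∀ a ∈ Metric.ball (Ψ p) δ, ContDiffAt ℝ (⊤ : ℕ∞) (f ∘ Φ) a := fun a ha =>
    (hf.contDiffAt (hU.mem_nhds (hball ha).1)).comp a (hΦs a ha)
  have hF0 : ∀ a ∈ Metric.ball (Ψ p) δ, ∀ v : Fin 4 → ℝ, v 2 = 0 →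
      fderiv ℝ (f ∘ Φ) a v = 0 := by
    intro a ha v hv
    have hfd : DifferentiableAt ℝ f (Φ a) :=
      (hf.contDiffAt (hU.mem_nhds (hball ha).1)).differentiableAt (by simp)
    have hΦd := (hΦs a ha).differentiableAt (by simp)
    rw [fderiv_comp a hfd hΦd]
    change fderiv ℝ f (Φ a) (fderiv ℝ Φ a v) = 0
    refine htan _ (hball ha).1 _ ?_
    have hS : (fun b => S (Φ b)) =ᶠ[nhds a] fun b => b 2 := by
      filter_upwards [Metric.isOpen_ball.mem_nhds ha] with b hb
      have hs := Real.sq_sqrt (le_of_lt (hball hb).2)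
      simp only [S, Φ, R, Matrix.cons_val] at hs ⊢
      linear_combination σ * σ * hs + (b 2 - b 1 ^ 2 + b 3 ^ 2) * hσ
    have hc := fun i => hasFDerivAt_pi'.1 hΦd.hasFDerivAt i
    have hSd := (((hc 1).pow 2).add ((hc 2).pow 2)).sub ((hc 3).pow 2)
    have := congrArg (fun L => L v) (hSd.unique ((hL 2 a).congr_of_eventuallyEq hS))
    simp at this
    linarith
  have hconst : ∀ a ∈ Metric.ball (Ψ p) δ, ∀ b ∈ Metric.ball (Ψ p) δ, a 2 = b 2 →
      f (Φ a) = f (Φ b) := by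
    intro a ha b hb hab
    obtain ⟨c, hc, h⟩ := domain_mvt (f := f ∘ Φ) (f' := fderiv ℝ (f ∘ Φ))
      (fun x hx => ((hF x hx).differentiableAt (by simp)).hasFDerivAt.hasFDerivWithinAt)
      (convex_ball (Ψ p) δ) hb ha
    rw [hF0 c ((convex_ball (Ψ p) δ).segment_subset hb ha hc) (a - b) (by simp [hab])] at h
    exact sub_eq_zero.1 h
  let ι : ℝ → (Fin 4 → ℝ) := fun s => ![p 0, p 1, s, p 3]
  have hι : ∀ s ∈ Metric.ball (S p) δ, ι s ∈ Metric.ball (Ψ p) δ := by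
    intro s hs
    refine (dist_pi_lt_iff hδ).2 fun i => ?_
    fin_cases i
    · simpa [ι, Ψ] using hδ
    · simpa [ι, Ψ] using hδ
    · exact hs
    · simpa [ι, Ψ] using hδ
  have hιs : ContDiff ℝ (⊤ : ℕ∞) ι := by
    refine contDiff_pi.2 fun i => ?_
    fin_cases i
    · exact contDiff_const
    · exact contDiff_const
    · exact contDiff_id
    · exact contDiff_const
  obtain ⟨g, hg, hgh⟩ := exists_contDiff_eqOn_ball (h := (f ∘ Φ) ∘ ι) hδ fun s hs =>
    ((hF _ (hι s hs)).comp s hιs.contDiffAt).contDiffWithinAt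
  refine ⟨U ∩ Ψ ⁻¹' Metric.ball (Ψ p) (δ / 3) ∩ {q | 0 < σ * q 2}, ?_, ⟨⟨hp, ?_⟩, hσp⟩,
    fun q hq => hq.1.1, g, hg, ?_⟩
  · exact (hU.inter (Metric.isOpen_ball.preimage hΨc)).inter
      (isOpen_lt continuous_const (by fun_prop))
  · exact Metric.mem_ball_self (by positivity)
  · rintro q ⟨⟨-, hq⟩, hqσ⟩
    have hq2 : S q ∈ Metric.ball (S p) (δ / 3) := (dist_le_pi_dist (Ψ q) (Ψ p) 2).trans_lt hq
    have hle : δ / 3 ≤ δ := by linarith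
    calc f q = f (Φ (Ψ q)) := by rw [hΦΨ q hqσ]
      _ = f (Φ (ι (S q))) := hconst _ (Metric.ball_subset_ball hle hq) _
          (hι _ (Metric.ball_subset_ball hle hq2)) rfl
      _ = g (S q) := (hgh hq2).symm
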